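/- arXiv:1312.6932 — 12 statements merged into one kernel-verified Lean document; each statement's English description precedes it below -/
import Mathlib

section
/- Let n ≥ 1 and let R be a Kähler algebraic curvature tensor on ℂ^n. Then R has nonpositive complex sectional curvature (i.e. for all a, b, c, d ∈ ℂ^n the complex sectional curvature expression CS(a,b,c,d) is a real number ≤ 0) if and only if R is strongly nonpositive in the sense of Siu (i.e. for all A, B, C, D ∈ ℂ^n, the Siu form Q(M) at the matrix M i j := A i * conj (B j) − C i * conj (D j) is a real number ≤ 0). (This is the algebraic, pointwise content of the paper's Theorem: a Kähler metric is strongly non-positive in the sense of Siu if and only if its complex sectional curvature is non-positive.) -/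
open Finset

/-- The complex sectional curvature expression `R(Z, W̄, W, Z̄)` where `Z` has
(1,0)-part `a` and (0,1)-part `b`, and `W` has (1,0)-part `c` and (0,1)-part `d`. -/
noncomputable def complexSectional {n : ℕ} (R : Fin n → Fin n → Fin n → Fin n → ℂ)
    (a b c d : Fin n → ℂ) : ℂ :=
  ∑ i, ∑ j, ∑ k, ∑ l,
    (R i j k l * a i * (starRingEnd ℂ) (c j) * c k * (starRingEnd ℂ) (a l)
      - R i j l k * a i * (starRingEnd ℂ) (c j) * d k * (starRingEnd ℂ) (b l)
      + R j i l k * b i * (starRingEnd ℂ) (d j) * d k * (starRingEnd ℂ) (b l)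
      - R j i k l * b i * (starRingEnd ℂ) (d j) * c k * (starRingEnd ℂ) (a l))

/-- The Siu quadratic form `Q(M) = ∑ R i j k l * M i j * conj (M l k)`. -/
noncomputable def siuForm {n : ℕ} (R : Fin n → Fin n → Fin n → Fin n → ℂ)
    (M : Matrix (Fin n) (Fin n) ℂ) : ℂ :=
  ∑ i, ∑ j, ∑ k, ∑ l, R i j k l * M i j * (starRingEnd ℂ) (M l k)

/-- The complex sectional curvature at `(a, b)`, `(c, d)` is the Siu form at the matrix
`a i * conj (c j) - conj (d i) * b j`. -/
theorem complexSectional_eq_siuForm {n : ℕ} (R : Fin n → Fin n → Fin n → Fin n → ℂ)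
    (a b c d : Fin n → ℂ) :
    complexSectional R a b c d =
      siuForm R (fun i j => a i * (starRingEnd ℂ) (c j) - (starRingEnd ℂ) (d i) * b j) := by
  have swap_fst (f : Fin n → Fin n → Fin n → Fin n → ℂ) :
      ∑ i, ∑ j, ∑ k, ∑ l, f j i k l = ∑ i, ∑ j, ∑ k, ∑ l, f i j k l := sum_comm
  have swap_snd (f : Fin n → Fin n → Fin n → Fin n → ℂ) :
      ∑ i, ∑ j, ∑ k, ∑ l, f i j l k = ∑ i, ∑ j, ∑ k, ∑ l, f i j k l :=
    sum_congr rfl fun _ _ => sum_congr rfl fun _ _ => sum_comm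
  unfold complexSectional siuForm
  simp only [sum_add_distrib, sum_sub_distrib]
  rw [swap_snd fun i j k l => R i j k l * a i * (starRingEnd ℂ) (c j) * d l *
      (starRingEnd ℂ) (b k),
    swap_fst fun i j k l => R i j l k * b j * (starRingEnd ℂ) (d i) * d k *
      (starRingEnd ℂ) (b l),
    swap_snd fun i j k l => R i j k l * b j * (starRingEnd ℂ) (d i) * d l *
      (starRingEnd ℂ) (b k),
    swap_fst fun i j k l => R i j k l * b j * (starRingEnd ℂ) (d i) * c k *
      (starRingEnd ℂ) (a l)]
  simp only [← sum_add_distrib, ← sum_sub_distrib]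
  refine sum_congr rfl fun i _ => sum_congr rfl fun j _ => sum_congr rfl fun k _ =>
    sum_congr rfl fun l _ => ?_
  simp only [map_sub, map_mul, Complex.conj_conj]
  ring

/-- A Kähler algebraic curvature tensor has nonpositive complex sectional curvature
if and only if it is strongly nonpositive in the sense of Siu. -/
theorem nonpos_complexSectional_iff_siu_strongly_nonpos (n : ℕ) (hn : 1 ≤ n)
    (R : Fin n → Fin n → Fin n → Fin n → ℂ)
    (hS1 : ∀ i j k l, R i j k l = R k j i l)
    (hS2 : ∀ i j k l, R i j k l = R i l k j)
    (hS3 : ∀ i j k l, (starRingEnd ℂ) (R i j k l) = R j i l k) :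
    (∀ a b c d : Fin n → ℂ,
        (complexSectional R a b c d).im = 0 ∧ (complexSectional R a b c d).re ≤ 0)
      ↔
    (∀ A B C D : Fin n → ℂ,
        (siuForm R (fun i j => A i * (starRingEnd ℂ) (B j) - C i * (starRingEnd ℂ) (D j))).im = 0 ∧
        (siuForm R (fun i j => A i * (starRingEnd ℂ) (B j) - C i * (starRingEnd ℂ) (D j))).re ≤ 0) := by
  constructor
  · intro h A B C D
    simpa only [complexSectional_eq_siuForm, Complex.conj_conj] using
      h A (fun j => (starRingEnd ℂ) (D j)) B (fun i => (starRingEnd ℂ) (C i))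
  · intro h a b c d
    simpa only [complexSectional_eq_siuForm, Complex.conj_conj] using
      h a c (fun i => (starRingEnd ℂ) (d i)) (fun j => (starRingEnd ℂ) (b j))
end

section
/- Let n ≥ 1 and let R : Fin n → Fin n → Fin n → Fin n → ℂ be any map (no symmetry assumptions needed). Then for all a, b, c, d ∈ ℂ^n, the complex sectional curvature expression CS(a,b,c,d) equals ∑_{i,j,k,l} (R i j k l) * (A i j) * conj (A l k), where A i j := (a i) * conj (c j) − (b j) * conj (d i). (This is the key computational identity in the paper's proof that strong nonpositivity in the sense of Siu is equivalent to nonpositive complex sectional curvature.) -/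
open Finset

/-- The complex sectional curvature expression equals
`∑ R i j k l * A i j * conj (A l k)` where `A i j = a i * conj (c j) - b j * conj (d i)`. -/
theorem complexSectional_eq_siuForm_of_matrix (n : ℕ) (hn : 1 ≤ n)
    (R : Fin n → Fin n → Fin n → Fin n → ℂ) (a b c d : Fin n → ℂ) :
    complexSectional R a b c d =
      ∑ i, ∑ j, ∑ k, ∑ l,
        R i j k l * (a i * (starRingEnd ℂ) (c j) - b j * (starRingEnd ℂ) (d i)) *
          (starRingEnd ℂ) (a l * (starRingEnd ℂ) (c k) - b k * (starRingEnd ℂ) (d l)) := by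
  have swap_last (f : Fin n → Fin n → Fin n → Fin n → ℂ) :
      ∑ i, ∑ j, ∑ k, ∑ l, f i j k l = ∑ i, ∑ j, ∑ k, ∑ l, f i j l k :=
    sum_congr rfl fun _ _ => sum_congr rfl fun _ _ => sum_comm
  have swap_first (f : Fin n → Fin n → Fin n → Fin n → ℂ) :
      ∑ i, ∑ j, ∑ k, ∑ l, f i j k l = ∑ i, ∑ j, ∑ k, ∑ l, f j i k l := sum_comm
  simp only [complexSectional, sum_add_distrib, sum_sub_distrib]
  rw [swap_last fun i j k l => R i j l k * a i * (starRingEnd ℂ) (c j) * d k *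
      (starRingEnd ℂ) (b l),
    swap_last fun i j k l => R j i l k * b i * (starRingEnd ℂ) (d j) * d k *
      (starRingEnd ℂ) (b l),
    swap_first fun i j k l => R j i k l * b i * (starRingEnd ℂ) (d j) * d l *
      (starRingEnd ℂ) (b k),
    swap_first fun i j k l => R j i k l * b i * (starRingEnd ℂ) (d j) * c k *
      (starRingEnd ℂ) (a l)]
  simp only [← sum_add_distrib, ← sum_sub_distrib, map_sub, map_mul, Complex.conj_conj]
  refine sum_congr rfl fun i _ => sum_congr rfl fun j _ => sum_congr rfl fun k _ =>
    sum_congr rfl fun l _ => ?_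
  ring
end

section
/- Let n ≥ 1 and let R be a Kähler algebraic curvature tensor on ℂ^n which is semi-dual-Nakano-nonpositive, i.e. the dual-Nakano form D(M) is a real number ≤ 0 for every M ∈ Matrix (Fin n) (Fin n) ℂ. Then for every anti-Hermitian matrix B ∈ Matrix (Fin n) (Fin n) ℂ, the quantity −∑_{i,j,k,l} (R i j k l) * (B i j) * (B k l) is a real number ≤ 0. (This is the algebraic, pointwise content of the paper's theorem that a Kähler metric with semi dual-Nakano-negative curvature has non-positive Riemannian curvature operator: anti-Hermitian matrices B are exactly the coefficient matrices of the (1,1)-components of real 2-vectors V, and the Riemannian curvature operator satisfies 𝓡(V,V) = −∑_{i,j,k,l} (R i j k l)·(B i j)·(B k l).) -/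
open Finset

/-- The dual-Nakano form `D(M) = ∑ R i j k l * M i l * conj (M j k)`. -/
noncomputable def dualNakanoForm {n : ℕ} (R : Fin n → Fin n → Fin n → Fin n → ℂ)
    (M : Matrix (Fin n) (Fin n) ℂ) : ℂ :=
  ∑ i, ∑ j, ∑ k, ∑ l, R i j k l * M i l * (starRingEnd ℂ) (M j k)

/-- On anti-Hermitian matrices the dual-Nakano form of a tensor symmetric in its conjugate indices
is the curvature operator form. -/
theorem dualNakanoForm_eq_of_antiHermitian {n : ℕ} {R : Fin n → Fin n → Fin n → Fin n → ℂ}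
    (hR : ∀ i j k l, R i j k l = R i l k j) {B : Matrix (Fin n) (Fin n) ℂ}
    (hB : ∀ i j, (starRingEnd ℂ) (B i j) = - B j i) :
    dualNakanoForm R B = -(∑ i, ∑ j, ∑ k, ∑ l, R i j k l * B i j * B k l) := by
  simp only [dualNakanoForm, hB, mul_neg, sum_neg_distrib, neg_inj]
  refine sum_congr rfl fun i _ => ?_
  rw [sum_comm]
  conv_rhs => rw [sum_comm]
  refine sum_congr rfl fun k _ => ?_
  rw [sum_comm]
  refine sum_congr rfl fun l _ => sum_congr rfl fun j _ => ?_
  rw [hR i j k l]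

/-- Semi-dual-Nakano-nonpositivity implies the Riemannian curvature operator is
nonpositive: for every anti-Hermitian matrix `B`, the quantity
`-∑ R i j k l * B i j * B k l` is a real number `≤ 0`. -/
theorem curvature_operator_nonpos_of_semi_dualNakano_nonpos (n : ℕ) (hn : 1 ≤ n)
    (R : Fin n → Fin n → Fin n → Fin n → ℂ)
    (hS1 : ∀ i j k l, R i j k l = R k j i l)
    (hS2 : ∀ i j k l, R i j k l = R i l k j)
    (hS3 : ∀ i j k l, (starRingEnd ℂ) (R i j k l) = R j i l k)
    (hDN : ∀ M : Matrix (Fin n) (Fin n) ℂ,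
        (dualNakanoForm R M).im = 0 ∧ (dualNakanoForm R M).re ≤ 0) :
    ∀ B : Matrix (Fin n) (Fin n) ℂ,
      (∀ i j, (starRingEnd ℂ) (B i j) = - B j i) →
      (-(∑ i, ∑ j, ∑ k, ∑ l, R i j k l * B i j * B k l)).im = 0 ∧
      (-(∑ i, ∑ j, ∑ k, ∑ l, R i j k l * B i j * B k l)).re ≤ 0 := by
  intro B hB
  rw [← dualNakanoForm_eq_of_antiHermitian hS2 hB]
  exact hDN B
end

section
/- Let n ≥ 1 and let R : Fin n → Fin n → Fin n → Fin n → ℂ satisfy the Kähler symmetry (S2): R i j k l = R i l k j for all indices. Then for every anti-Hermitian matrix B ∈ Matrix (Fin n) (Fin n) ℂ, one has −∑_{i,j,k,l} (R i j k l) * (B i j) * (B k l) = D(B), where D is the dual-Nakano form. (This identity is the core of the paper's proof that semi dual-Nakano-negativity implies non-positivity of the Riemannian curvature operator: the curvature operator value on the real 2-vector with (1,1)-part B equals the dual-Nakano form evaluated at B.) -/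
open Finset

/-- For a tensor with the Kähler symmetry (S2) and an anti-Hermitian matrix `B`,
the Riemannian curvature operator value `-∑ R i j k l * B i j * B k l`
equals the dual-Nakano form `D(B)`. -/
theorem curvature_operator_eq_dualNakanoForm (n : ℕ) (hn : 1 ≤ n)
    (R : Fin n → Fin n → Fin n → Fin n → ℂ)
    (hS2 : ∀ i j k l, R i j k l = R i l k j)
    (B : Matrix (Fin n) (Fin n) ℂ)
    (hB : ∀ i j, (starRingEnd ℂ) (B i j) = - B j i) :
    -(∑ i, ∑ j, ∑ k, ∑ l, R i j k l * B i j * B k l) = dualNakanoForm R B := by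
  simp only [dualNakanoForm, hB, mul_neg, sum_neg_distrib, neg_inj]
  refine sum_congr rfl fun i _ => ?_
  calc ∑ j, ∑ k, ∑ l, R i j k l * B i j * B k l
      = ∑ k, ∑ j, ∑ l, R i j k l * B i j * B k l := sum_comm
    _ = ∑ k, ∑ l, ∑ j, R i j k l * B i j * B k l := sum_congr rfl fun _ _ => sum_comm
    _ = ∑ l, ∑ k, ∑ j, R i j k l * B i j * B k l := sum_comm
    _ = ∑ j, ∑ k, ∑ l, R i j k l * B i l * B k j := by simp only [hS2 i]
end

section
/- Let n ≥ 1 and let R be a Kähler algebraic curvature tensor on ℂ^n. Suppose that for every anti-Hermitian matrix B ∈ Matrix (Fin n) (Fin n) ℂ the quantity −∑_{i,j,k,l} (R i j k l) * (B i j) * (B k l) is a real number ≤ 0 (non-positive Riemannian curvature operator). Then R is strongly nonpositive in the sense of Siu: for all A, B, C, D ∈ ℂ^n, the Siu form Q(M) at the matrix M i j := A i * conj (B j) − C i * conj (D j) is a real number ≤ 0. (This is the algebraic, pointwise content of the implication 'non-positive Riemannian curvature operator ⟹ strongly non-positive in the sense of Siu' in the paper's list of curvature relations on Kähler manifolds.)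 -/
open Finset

/-- The Siu form of `M` is minus the sum of the curvature operator forms of the anti-Hermitian
matrices `(M - Mᴴ) / 2` and `-I * (M + Mᴴ) / 2`. -/
theorem siuForm_eq_neg_add_neg {n : ℕ} (R : Fin n → Fin n → Fin n → Fin n → ℂ)
    (hR : ∀ i j k l, R i j k l = R k l i j) (M S U : Matrix (Fin n) (Fin n) ℂ)
    (hS : ∀ i j, S i j = (M i j - (starRingEnd ℂ) (M j i)) / 2)
    (hU : ∀ i j, U i j = -Complex.I * (M i j + (starRingEnd ℂ) (M j i)) / 2) :
    siuForm R M = -(∑ i, ∑ j, ∑ k, ∑ l, R i j k l * S i j * S k l) +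
      -(∑ i, ∑ j, ∑ k, ∑ l, R i j k l * U i j * U k l) := by
  have swap : siuForm R M =
      ∑ i, ∑ j, ∑ k, ∑ l, R i j k l * (starRingEnd ℂ) (M j i) * M k l := by
    have h := sum_comm (s := univ) (t := univ) (f := fun p q : Fin n × Fin n =>
      R p.1 p.2 q.1 q.2 * M p.1 p.2 * (starRingEnd ℂ) (M q.2 q.1))
    simp only [Fintype.sum_prod_type] at h
    refine h.trans (sum_congr rfl fun i _ => sum_congr rfl fun j _ => sum_congr rfl fun k _ =>
      sum_congr rfl fun l _ => ?_)
    rw [hR k l i j]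
    ring
  have double : 2 * siuForm R M = 2 * (-(∑ i, ∑ j, ∑ k, ∑ l, R i j k l * S i j * S k l) +
      -(∑ i, ∑ j, ∑ k, ∑ l, R i j k l * U i j * U k l)) := by
    rw [two_mul]
    nth_rewrite 2 [swap]
    unfold siuForm
    simp only [← sum_neg_distrib, ← sum_add_distrib, mul_sum]
    refine sum_congr rfl fun i _ => sum_congr rfl fun j _ => sum_congr rfl fun k _ =>
      sum_congr rfl fun l _ => ?_
    rw [hS, hS, hU, hU]
    linear_combination (R i j k l * (M i j + (starRingEnd ℂ) (M j i)) *
      (M k l + (starRingEnd ℂ) (M l k)) / 2) * Complex.I_sq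
  exact mul_left_cancel₀ two_ne_zero double

/-- A Kähler algebraic curvature tensor with nonpositive Riemannian curvature
operator is strongly nonpositive in the sense of Siu. -/
theorem siu_strongly_nonpos_of_curvature_operator_nonpos (n : ℕ) (hn : 1 ≤ n)
    (R : Fin n → Fin n → Fin n → Fin n → ℂ)
    (hS1 : ∀ i j k l, R i j k l = R k j i l)
    (hS2 : ∀ i j k l, R i j k l = R i l k j)
    (hS3 : ∀ i j k l, (starRingEnd ℂ) (R i j k l) = R j i l k)
    (hOp : ∀ B : Matrix (Fin n) (Fin n) ℂ,
        (∀ i j, (starRingEnd ℂ) (B i j) = - B j i) →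
        (-(∑ i, ∑ j, ∑ k, ∑ l, R i j k l * B i j * B k l)).im = 0 ∧
        (-(∑ i, ∑ j, ∑ k, ∑ l, R i j k l * B i j * B k l)).re ≤ 0) :
    ∀ A B C D : Fin n → ℂ,
      (siuForm R (fun i j => A i * (starRingEnd ℂ) (B j) - C i * (starRingEnd ℂ) (D j))).im = 0 ∧
      (siuForm R (fun i j => A i * (starRingEnd ℂ) (B j) - C i * (starRingEnd ℂ) (D j))).re ≤ 0 := by
  intro A B C D
  generalize (fun i j => A i * (starRingEnd ℂ) (B j) - C i * (starRingEnd ℂ) (D j) :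
    Matrix (Fin n) (Fin n) ℂ) = M
  let S : Matrix (Fin n) (Fin n) ℂ := fun i j => (M i j - (starRingEnd ℂ) (M j i)) / 2
  let U : Matrix (Fin n) (Fin n) ℂ :=
    fun i j => -Complex.I * (M i j + (starRingEnd ℂ) (M j i)) / 2
  have hS := hOp S fun i j => by simp [S, map_ofNat]; ring
  have hU := hOp U fun i j => by simp [U, map_ofNat]; ring
  rw [siuForm_eq_neg_add_neg R (fun i j k l => (hS1 i j k l).trans (hS2 k j i l)) M S U
    (fun _ _ => rfl) (fun _ _ => rfl), Complex.add_im, Complex.add_re]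
  exact ⟨by rw [hS.1, hU.1, add_zero], add_nonpos hS.2 hU.2⟩
end

section
/- Let n ≥ 1 and let R be a Kähler algebraic curvature tensor on ℂ^n. For any M ∈ Matrix (Fin n) (Fin n) ℂ, let B₁ := (M − M†)/2 and B₂ := (M + M†)/(2·i), where M† is the conjugate transpose of M (so B₁ and B₂ are anti-Hermitian and M = B₁ + i·B₂). Then the Siu form satisfies Q(M) = Q(B₁) + Q(B₂). (This decomposition identity underlies the implication from non-positivity of the Riemannian curvature operator to non-positive complex sectional curvature.) -/
open Finset

/-- Exchanging the index pairs `(i, j)` and `(k, l)` does not change a fourfold sum. -/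
theorem sum_index_pairs_comm {ι α : Type*} [Fintype ι] [AddCommMonoid α]
    (f : ι → ι → ι → ι → α) :
    ∑ i, ∑ j, ∑ k, ∑ l, f i j k l = ∑ i, ∑ j, ∑ k, ∑ l, f k l i j := by
  have h := Finset.sum_comm (s := univ) (t := univ)
    (f := fun (p q : ι × ι) => f p.1 p.2 q.1 q.2)
  simpa only [Fintype.sum_prod_type] using h

/-- If `R` is symmetric in its unbarred and in its barred indices, the Siu form takes the same
value at `M` and at its conjugate transpose. -/
theorem siuForm_eq_sum_conj_transpose {n : ℕ} (R : Fin n → Fin n → Fin n → Fin n → ℂ)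
    (hS1 : ∀ i j k l, R i j k l = R k j i l)
    (hS2 : ∀ i j k l, R i j k l = R i l k j)
    (M : Matrix (Fin n) (Fin n) ℂ) :
    siuForm R M = ∑ i, ∑ j, ∑ k, ∑ l, R i j k l * (starRingEnd ℂ) (M j i) * M k l := by
  rw [siuForm, sum_index_pairs_comm]
  refine sum_congr rfl fun i _ => sum_congr rfl fun j _ => sum_congr rfl fun k _ =>
    sum_congr rfl fun l _ => ?_
  rw [hS1 k l i j, hS2 i l k j]
  ring

/-- Decomposing `M = B₁ + i·B₂` into its anti-Hermitian parts
`B₁ = (M - M†)/2` and `B₂ = (M + M†)/(2i)`, the Siu form satisfies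
`Q(M) = Q(B₁) + Q(B₂)`. -/
theorem siuForm_antiHermitian_decomposition (n : ℕ) (hn : 1 ≤ n)
    (R : Fin n → Fin n → Fin n → Fin n → ℂ)
    (hS1 : ∀ i j k l, R i j k l = R k j i l)
    (hS2 : ∀ i j k l, R i j k l = R i l k j)
    (hS3 : ∀ i j k l, (starRingEnd ℂ) (R i j k l) = R j i l k)
    (M : Matrix (Fin n) (Fin n) ℂ) :
    siuForm R M =
      siuForm R (fun i j => (M i j - (starRingEnd ℂ) (M j i)) / 2) +
      siuForm R (fun i j => (M i j + (starRingEnd ℂ) (M j i)) / (2 * Complex.I)) := by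
  have hM : siuForm R M = (siuForm R M + siuForm R M) / 2 := by ring
  rw [hM]
  nth_rewrite 2 [siuForm_eq_sum_conj_transpose R hS1 hS2 M]
  simp only [siuForm, ← sum_add_distrib, sum_div]
  refine sum_congr rfl fun i _ => sum_congr rfl fun j _ => sum_congr rfl fun k _ =>
    sum_congr rfl fun l _ => ?_
  simp only [map_div₀, map_sub, map_add, map_mul, Complex.conj_conj, Complex.conj_I,
    map_ofNat]
  field_simp
  simp only [Complex.I_sq]
  ring
end

section
/- Let n ≥ 1 and let R be a Kähler algebraic curvature tensor on ℂ^n. Suppose R has nonpositive Riemannian sectional curvature, i.e. for all x, y ∈ ℂ^n the Siu form Q(S(x,y)) at the sectional matrix S(x,y) i j := (x i) * conj (y j) − (y i) * conj (x j) is a real number ≤ 0. Then R has nonpositive holomorphic bisectional curvature: for all ξ, η ∈ ℂ^n, the quantity ∑_{i,j,k,l} (R i j k l) * (ξ i) * conj (ξ j) * (η k) * conj (η l) is a real number ≤ 0. (This is the algebraic, pointwise content of the implication 'non-positive Riemannian sectional curvature ⟹ non-positive holomorphic bisectional curvature' in the paper's list of curvature relations on Kähler manifolds; the sectional matrix S(x,y)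 is the (1,1)-part of X ∧ Y for the real tangent vectors X, Y with holomorphic parts x, y.) -/
open Finset

/-- Averaging the Siu form over the sectional matrices of `(x, y)` and `(x, I y)` gives the
holomorphic bisectional curvature. -/
theorem siuForm_add_siuForm_I {n : ℕ} (R : Fin n → Fin n → Fin n → Fin n → ℂ)
    (hS1 : ∀ i j k l, R i j k l = R k j i l)
    (hS2 : ∀ i j k l, R i j k l = R i l k j) (x y : Fin n → ℂ) :
    siuForm R (fun i j => x i * (starRingEnd ℂ) (y j) - y i * (starRingEnd ℂ) (x j)) +
      siuForm R (fun i j => x i * (starRingEnd ℂ) (Complex.I * y j) -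
        Complex.I * y i * (starRingEnd ℂ) (x j)) =
    4 * ∑ i, ∑ j, ∑ k, ∑ l,
      R i j k l * x i * (starRingEnd ℂ) (x j) * y k * (starRingEnd ℂ) (y l) := by
  have swap_bar : ∑ i, ∑ j, ∑ k, ∑ l,
        R i j k l * x i * (starRingEnd ℂ) (y j) * y k * (starRingEnd ℂ) (x l) =
      ∑ i, ∑ j, ∑ k, ∑ l,
        R i j k l * x i * (starRingEnd ℂ) (x j) * y k * (starRingEnd ℂ) (y l) := by
    refine sum_congr rfl fun i _ => ?_
    rw [sum_comm]
    conv_rhs => rw [sum_comm]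
    refine sum_congr rfl fun k _ => ?_
    rw [sum_comm]
    refine sum_congr rfl fun j _ => sum_congr rfl fun l _ => ?_
    rw [hS2]
    ring
  have swap_both : ∑ i, ∑ j, ∑ k, ∑ l,
        R i j k l * y i * (starRingEnd ℂ) (x j) * x k * (starRingEnd ℂ) (y l) =
      ∑ i, ∑ j, ∑ k, ∑ l,
        R i j k l * x i * (starRingEnd ℂ) (x j) * y k * (starRingEnd ℂ) (y l) := by
    rw [sum_comm]
    conv_rhs => rw [sum_comm]
    refine sum_congr rfl fun j _ => ?_
    rw [sum_comm]
    refine sum_congr rfl fun i _ => sum_congr rfl fun k _ => sum_congr rfl fun l _ => ?_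
    rw [hS1]
    ring
  have expand : siuForm R
        (fun i j => x i * (starRingEnd ℂ) (y j) - y i * (starRingEnd ℂ) (x j)) +
      siuForm R (fun i j => x i * (starRingEnd ℂ) (Complex.I * y j) -
        Complex.I * y i * (starRingEnd ℂ) (x j)) =
      2 * (∑ i, ∑ j, ∑ k, ∑ l,
          R i j k l * x i * (starRingEnd ℂ) (y j) * y k * (starRingEnd ℂ) (x l) +
        ∑ i, ∑ j, ∑ k, ∑ l,
          R i j k l * y i * (starRingEnd ℂ) (x j) * x k * (starRingEnd ℂ) (y l)) := by
    simp only [siuForm, ← sum_add_distrib, mul_sum]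
    refine sum_congr rfl fun i _ => sum_congr rfl fun j _ => sum_congr rfl fun k _ =>
      sum_congr rfl fun l _ => ?_
    simp only [map_sub, map_mul, map_neg, Complex.conj_conj, Complex.conj_I]
    linear_combination (-(R i j k l) *
      (x i * (starRingEnd ℂ) (y j) + y i * (starRingEnd ℂ) (x j)) *
      ((starRingEnd ℂ) (x l) * y k + (starRingEnd ℂ) (y l) * x k)) * Complex.I_sq
  rw [expand, swap_bar, swap_both]
  ring

/-- Nonpositive Riemannian sectional curvature implies nonpositive holomorphic
bisectional curvature, for a Kähler algebraic curvature tensor. -/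
theorem bisectional_nonpos_of_sectional_nonpos (n : ℕ) (hn : 1 ≤ n)
    (R : Fin n → Fin n → Fin n → Fin n → ℂ)
    (hS1 : ∀ i j k l, R i j k l = R k j i l)
    (hS2 : ∀ i j k l, R i j k l = R i l k j)
    (hS3 : ∀ i j k l, (starRingEnd ℂ) (R i j k l) = R j i l k)
    (hSec : ∀ x y : Fin n → ℂ,
        (siuForm R (fun i j => x i * (starRingEnd ℂ) (y j) - y i * (starRingEnd ℂ) (x j))).im = 0 ∧
        (siuForm R (fun i j => x i * (starRingEnd ℂ) (y j) - y i * (starRingEnd ℂ) (x j))).re ≤ 0) :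
    ∀ ξ η : Fin n → ℂ,
      (∑ i, ∑ j, ∑ k, ∑ l,
          R i j k l * ξ i * (starRingEnd ℂ) (ξ j) * η k * (starRingEnd ℂ) (η l)).im = 0 ∧
      (∑ i, ∑ j, ∑ k, ∑ l,
          R i j k l * ξ i * (starRingEnd ℂ) (ξ j) * η k * (starRingEnd ℂ) (η l)).re ≤ 0 := by
  intro ξ η
  have hsum := siuForm_add_siuForm_I R hS1 hS2 ξ η
  obtain ⟨him, hre⟩ := hSec ξ η
  obtain ⟨him_I, hre_I⟩ := hSec ξ (fun i => Complex.I * η i)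
  have h_re := congrArg Complex.re hsum
  have h_im := congrArg Complex.im hsum
  simp only [Complex.add_re, Complex.add_im, Complex.mul_re, Complex.mul_im, Complex.re_ofNat,
    Complex.im_ofNat, zero_mul, sub_zero, add_zero] at h_re h_im
  exact ⟨by linarith, by linarith⟩
end

section
/- Let (Ω, 𝒜, μ) be a σ-finite measure space, G : Ω × Ω → ℝ measurable, symmetric (G(z,w) = G(w,z)) and nonnegative (G(z,w) ≥ 0), and let θ : Fin m → Ω → ℂ be measurable functions such that for all indices i, j, α, β ∈ Fin m the function (z,w) ↦ G(z,w)·θ i (w)·conj(θ α (w))·conj(θ j (z))·θ β (z) is integrable with respect to μ ⊗ μ. Define the Wolpert curvature coefficients R i j α β := ∬ G(z,w)·θ i (w)·conj(θ α (w))·conj(θ j (z))·θ β (z) d(μ⊗μ) + ∬ G(z,w)·θ i (w)·conj(θ j (w))·conj(θ α (z))·θ β (z) d(μ⊗μ). Then for every u ∈ Matrix (Fin m) (Fin m) ℂ, the sum ∑_{i,j,α,β} (R i j α β)·(u i β)·conj(u j α) is a real number ≥ 0. (This is the dual-Nakano semi-positivity inequality (the paper's inequality R_{i j̄ α β̄}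 u^{iβ} ū^{jα} ≥ 0) proved for Wolpert's curvature formula of the Weil–Petersson metric, where G is the Green kernel of (Δ₀+1)^{-1} and θ i are harmonic Beltrami differentials; it shows the cotangent curvature is semi-dual-Nakano-positive, i.e. the Weil–Petersson metric is semi-dual-Nakano-negative.) -/
open MeasureTheory Finset

/-- If the sum of `F` and its swap is pointwise a nonnegative real, so is the integral of `F`. -/
lemma integral_prod_nonneg_of_add_swap {Ω : Type*} [MeasurableSpace Ω]
    {μ : Measure Ω} [SFinite μ] {F : Ω × Ω → ℂ} (hF : Integrable F (μ.prod μ))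
    {g : Ω × Ω → ℝ} (hg : ∀ p, 0 ≤ g p) (h : ∀ p, F p + F p.swap = g p) :
    (∫ p, F p ∂(μ.prod μ)).im = 0 ∧ 0 ≤ (∫ p, F p ∂(μ.prod μ)).re := by
  have key : (∫ p, F p ∂(μ.prod μ)) + ∫ p, F p ∂(μ.prod μ) =
      ((∫ p, g p ∂(μ.prod μ) : ℝ) : ℂ) := by
    nth_rw 2 [← integral_prod_swap (μ := μ) (ν := μ) F]
    rw [← integral_add hF (show Integrable (fun p : Ω × Ω => F p.swap) _ from hF.swap), ← integral_complex_ofReal]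
    exact integral_congr_ae (.of_forall h)
  have hnn : 0 ≤ ∫ p, g p ∂(μ.prod μ) := integral_nonneg hg
  have hre := congrArg Complex.re key
  have him := congrArg Complex.im key
  simp only [Complex.add_re, Complex.add_im, Complex.ofReal_re, Complex.ofReal_im] at hre him
  constructor <;> linarith

/-- The bilinear form `∑ u i β · θᵢ(w) · θ_β(z)` attached to a matrix `u`. -/
noncomputable def bilinearSum {Ω : Type*} {m : ℕ} (θ : Fin m → Ω → ℂ)
    (u : Matrix (Fin m) (Fin m) ℂ) (p : Ω × Ω) : ℂ :=
  ∑ i, ∑ β, u i β * θ i p.2 * θ β p.1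

/-- The contraction of the Wolpert integrand with `u ⊗ conj u`, in terms of `bilinearSum`. -/
lemma sum_wolpert_integrand {Ω : Type*} {m : ℕ} (G : Ω × Ω → ℝ) (θ : Fin m → Ω → ℂ)
    (u : Matrix (Fin m) (Fin m) ℂ) (p : Ω × Ω) :
    ∑ i, ∑ j, ∑ α, ∑ β, ((G p : ℂ) * θ i p.2 * (starRingEnd ℂ) (θ α p.2) *
          (starRingEnd ℂ) (θ j p.1) * θ β p.1 +
        (G p : ℂ) * θ i p.2 * (starRingEnd ℂ) (θ j p.2) *
          (starRingEnd ℂ) (θ α p.1) * θ β p.1) * u i β * (starRingEnd ℂ) (u j α) =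
      G p * bilinearSum θ u p *
        (starRingEnd ℂ) (bilinearSum θ u p.swap + bilinearSum θ u p) := by
  have hsum : (starRingEnd ℂ) (bilinearSum θ u p.swap + bilinearSum θ u p) =
      ∑ j, ∑ α, (starRingEnd ℂ) (u j α * θ j p.1 * θ α p.2 + u j α * θ j p.2 * θ α p.1) := by
    simp only [bilinearSum, Prod.fst_swap, Prod.snd_swap, ← Finset.sum_add_distrib, map_sum]
  rw [hsum, mul_assoc, bilinearSum, Finset.sum_mul_sum, Finset.mul_sum]
  refine Finset.sum_congr rfl fun i _ => ?_
  rw [Finset.mul_sum]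
  refine Finset.sum_congr rfl fun j _ => ?_
  rw [Finset.sum_comm, Finset.sum_mul_sum, Finset.mul_sum]
  refine Finset.sum_congr rfl fun β _ => ?_
  rw [Finset.mul_sum]
  refine Finset.sum_congr rfl fun α _ => ?_
  simp only [map_add, map_mul]
  ring

/-- Dual-Nakano semi-positivity of Wolpert's curvature coefficients
`R i j α β = ∬ G·θᵢ(w)·conj θ_α(w)·conj θ_j(z)·θ_β(z) + ∬ G·θᵢ(w)·conj θ_j(w)·conj θ_α(z)·θ_β(z)`:
for every matrix `u`, `∑ R i j α β · u i β · conj (u j α)` is a real number `≥ 0`. -/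
theorem wolpert_dualNakano_semipositive {Ω : Type*} [MeasurableSpace Ω]
    (μ : Measure Ω) [SigmaFinite μ]
    (G : Ω × Ω → ℝ) (hGmeas : Measurable G)
    (hGsymm : ∀ z w, G (z, w) = G (w, z))
    (hGnonneg : ∀ z w, 0 ≤ G (z, w))
    (m : ℕ) (θ : Fin m → Ω → ℂ) (hθmeas : ∀ i, Measurable (θ i))
    (hint : ∀ i j α β : Fin m, Integrable (fun p : Ω × Ω =>
        (G p : ℂ) * θ i p.2 * (starRingEnd ℂ) (θ α p.2) *
          (starRingEnd ℂ) (θ j p.1) * θ β p.1) (μ.prod μ))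
    (R : Fin m → Fin m → Fin m → Fin m → ℂ)
    (hR : ∀ i j α β : Fin m, R i j α β =
        (∫ p : Ω × Ω, (G p : ℂ) * θ i p.2 * (starRingEnd ℂ) (θ α p.2) *
          (starRingEnd ℂ) (θ j p.1) * θ β p.1 ∂(μ.prod μ)) +
        (∫ p : Ω × Ω, (G p : ℂ) * θ i p.2 * (starRingEnd ℂ) (θ j p.2) *
          (starRingEnd ℂ) (θ α p.1) * θ β p.1 ∂(μ.prod μ))) :
    ∀ u : Matrix (Fin m) (Fin m) ℂ,
      (∑ i, ∑ j, ∑ α, ∑ β, R i j α β * u i β * (starRingEnd ℂ) (u j α)).im = 0 ∧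
      0 ≤ (∑ i, ∑ j, ∑ α, ∑ β, R i j α β * u i β * (starRingEnd ℂ) (u j α)).re := by
  intro u
  let f (i j α β : Fin m) (p : Ω × Ω) : ℂ :=
    ((G p : ℂ) * θ i p.2 * (starRingEnd ℂ) (θ α p.2) * (starRingEnd ℂ) (θ j p.1) * θ β p.1 +
      (G p : ℂ) * θ i p.2 * (starRingEnd ℂ) (θ j p.2) *
        (starRingEnd ℂ) (θ α p.1) * θ β p.1) * u i β * (starRingEnd ℂ) (u j α)
  have hf i j α β : Integrable (f i j α β) (μ.prod μ) :=
    (((hint i j α β).add (hint i α j β)).mul_const _).mul_const _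
  have hf₁ i j α : Integrable (fun p => ∑ β, f i j α β p) (μ.prod μ) :=
    integrable_finsetSum _ fun β _ => hf i j α β
  have hf₂ i j : Integrable (fun p => ∑ α, ∑ β, f i j α β p) (μ.prod μ) :=
    integrable_finsetSum _ fun α _ => hf₁ i j α
  have hf₃ i : Integrable (fun p => ∑ j, ∑ α, ∑ β, f i j α β p) (μ.prod μ) :=
    integrable_finsetSum _ fun j _ => hf₂ i j
  have hf₄ : Integrable (fun p => ∑ i, ∑ j, ∑ α, ∑ β, f i j α β p) (μ.prod μ) :=
    integrable_finsetSum _ fun i _ => hf₃ i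
  have hS : ∑ i, ∑ j, ∑ α, ∑ β, R i j α β * u i β * (starRingEnd ℂ) (u j α) =
      ∫ p, ∑ i, ∑ j, ∑ α, ∑ β, f i j α β p ∂(μ.prod μ) := by
    rw [integral_finsetSum _ fun i _ => hf₃ i]
    refine Finset.sum_congr rfl fun i _ => ?_
    rw [integral_finsetSum _ fun j _ => hf₂ i j]
    refine Finset.sum_congr rfl fun j _ => ?_
    rw [integral_finsetSum _ fun α _ => hf₁ i j α]
    refine Finset.sum_congr rfl fun α _ => ?_
    rw [integral_finsetSum _ fun β _ => hf i j α β]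
    refine Finset.sum_congr rfl fun β _ => ?_
    rw [hR, ← integral_add (hint i j α β) (hint i α j β), ← integral_mul_const,
      ← integral_mul_const]
  rw [hS]
  refine integral_prod_nonneg_of_add_swap hf₄
    (g := fun p => G p * Complex.normSq (bilinearSum θ u p + bilinearSum θ u p.swap))
    (fun p => mul_nonneg (hGnonneg p.1 p.2) (Complex.normSq_nonneg _)) fun p => ?_
  have hG : G p.swap = G p := hGsymm p.2 p.1
  simp only [f]
  rw [sum_wolpert_integrand, sum_wolpert_integrand, Prod.swap_swap, hG, Complex.ofReal_mul,
    Complex.normSq_eq_conj_mul_self, map_add, map_add]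
  ring
end

section
/- Let (Ω, 𝒜, μ) be a σ-finite measure space, G : Ω × Ω → ℝ measurable, symmetric (G(z,w) = G(w,z)) and nonnegative (G(z,w) ≥ 0), and assume moreover that G is a positive-semidefinite kernel: for every measurable f : Ω → ℂ such that (z,w) ↦ G(z,w)·f(w)·conj(f(z)) is μ⊗μ-integrable, the integral ∬ G(z,w)·f(w)·conj(f(z)) d(μ⊗μ) is a real number ≥ 0. Let θ : Fin m → Ω → ℂ be measurable functions such that for all indices i, j, α, β ∈ Fin m the function (z,w) ↦ G(z,w)·θ i (w)·conj(θ α (w))·conj(θ j (z))·θ β (z) is integrable with respect to μ ⊗ μ, and define R i j α β := ∬ G(z,w)·θ i (w)·conj(θ α (w))·conj(θ j (z))·θ β (z) d(μ⊗μ) + ∬ G(z,w)·θ i (w)·conj(θ j (w))·conj(θ α (z))·θ β (z) d(μ⊗μ). Then for every u ∈ Matrix (Fin m) (Fin m) ℂ, the sum ∑_{i,j,α,β} (R i j α β)·(u i α)·conj(u j β) is a real number ≥ 0. (This is the Nakano semi-positivity part of the paper's theorem that the Weil–Petersson metric on the moduli space of curves of genus ≥ 2 is semi-Nakano-negative: the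 kernel G of the positive operator (Δ₀+1)^{-1} satisfies the hypotheses, and the stated sum is the Nakano form of Wolpert's curvature tensor on the cotangent bundle.) -/
open MeasureTheory Finset

theorem sum_integral_mul_const {X ι : Type*} [Fintype ι] [MeasurableSpace X] {ν : Measure X}
    (K : ι → ι → ι → ι → X → ℂ) (hK : ∀ i j α β, Integrable (K i j α β) ν)
    (c : ι → ι → ι → ι → ℂ) :
    Integrable (fun p => ∑ i, ∑ j, ∑ α, ∑ β, K i j α β p * c i j α β) ν ∧
      ∑ i, ∑ j, ∑ α, ∑ β, (∫ p, K i j α β p ∂ν) * c i j α β =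
        ∫ p, ∑ i, ∑ j, ∑ α, ∑ β, K i j α β p * c i j α β ∂ν := by
  have h₁ : ∀ i j α β, Integrable (fun p => K i j α β p * c i j α β) ν :=
    fun i j α β => (hK i j α β).mul_const _
  have h₂ : ∀ i j α, Integrable (fun p => ∑ β, K i j α β p * c i j α β) ν :=
    fun i j α => integrable_finsetSum _ fun β _ => h₁ i j α β
  have h₃ : ∀ i j, Integrable (fun p => ∑ α, ∑ β, K i j α β p * c i j α β) ν :=
    fun i j => integrable_finsetSum _ fun α _ => h₂ i j α
  have h₄ : ∀ i, Integrable (fun p => ∑ j, ∑ α, ∑ β, K i j α β p * c i j α β) ν :=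
    fun i => integrable_finsetSum _ fun j _ => h₃ i j
  refine ⟨integrable_finsetSum _ fun i _ => h₄ i, ?_⟩
  rw [integral_finsetSum _ fun i _ => h₄ i]
  refine sum_congr rfl fun i _ => ?_
  rw [integral_finsetSum _ fun j _ => h₃ i j]
  refine sum_congr rfl fun j _ => ?_
  rw [integral_finsetSum _ fun α _ => h₂ i j α]
  refine sum_congr rfl fun α _ => ?_
  rw [integral_finsetSum _ fun β _ => h₁ i j α β]
  exact sum_congr rfl fun β _ => (integral_mul_const _ _).symm

theorem mul_sum_mul_sum {ι : Type*} [Fintype ι] (g : ℂ) (a b : ι → ι → ℂ) :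
    g * (∑ i, ∑ α, a i α) * (∑ j, ∑ β, b j β) =
      ∑ i, ∑ j, ∑ α, ∑ β, g * a i α * b j β := by
  rw [mul_assoc, sum_mul_sum, mul_sum]
  refine sum_congr rfl fun i _ => ?_
  rw [mul_sum]
  refine sum_congr rfl fun j _ => ?_
  rw [sum_mul_sum, mul_sum]
  refine sum_congr rfl fun α _ => ?_
  rw [mul_sum]
  exact sum_congr rfl fun β _ => (mul_assoc _ _ _).symm

/-- Nakano semi-positivity of Wolpert's curvature coefficients for a symmetric,
nonnegative, positive-semidefinite kernel `G`: for every matrix `u`,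
`∑ R i j α β · u i α · conj (u j β)` is a real number `≥ 0`. -/
theorem wolpert_nakano_semipositive {Ω : Type*} [MeasurableSpace Ω]
    (μ : Measure Ω) [SigmaFinite μ]
    (G : Ω × Ω → ℝ) (hGmeas : Measurable G)
    (hGsymm : ∀ z w, G (z, w) = G (w, z))
    (hGnonneg : ∀ z w, 0 ≤ G (z, w))
    (hGpsd : ∀ f : Ω → ℂ, Measurable f →
      Integrable (fun p : Ω × Ω =>
        (G p : ℂ) * f p.2 * (starRingEnd ℂ) (f p.1)) (μ.prod μ) →
      ((∫ p : Ω × Ω, (G p : ℂ) * f p.2 * (starRingEnd ℂ) (f p.1) ∂(μ.prod μ)).im = 0 ∧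
        0 ≤ (∫ p : Ω × Ω, (G p : ℂ) * f p.2 * (starRingEnd ℂ) (f p.1) ∂(μ.prod μ)).re))
    (m : ℕ) (θ : Fin m → Ω → ℂ) (hθmeas : ∀ i, Measurable (θ i))
    (hint : ∀ i j α β : Fin m, Integrable (fun p : Ω × Ω =>
        (G p : ℂ) * θ i p.2 * (starRingEnd ℂ) (θ α p.2) *
          (starRingEnd ℂ) (θ j p.1) * θ β p.1) (μ.prod μ))
    (R : Fin m → Fin m → Fin m → Fin m → ℂ)
    (hR : ∀ i j α β : Fin m, R i j α β =
        (∫ p : Ω × Ω, (G p : ℂ) * θ i p.2 * (starRingEnd ℂ) (θ α p.2) *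
          (starRingEnd ℂ) (θ j p.1) * θ β p.1 ∂(μ.prod μ)) +
        (∫ p : Ω × Ω, (G p : ℂ) * θ i p.2 * (starRingEnd ℂ) (θ j p.2) *
          (starRingEnd ℂ) (θ α p.1) * θ β p.1 ∂(μ.prod μ))) :
    ∀ u : Matrix (Fin m) (Fin m) ℂ,
      (∑ i, ∑ j, ∑ α, ∑ β, R i j α β * u i α * (starRingEnd ℂ) (u j β)).im = 0 ∧
      0 ≤ (∑ i, ∑ j, ∑ α, ∑ β, R i j α β * u i α * (starRingEnd ℂ) (u j β)).re := by
  intro u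
  set c : Fin m → Fin m → Fin m → Fin m → ℂ :=
    fun i j α β => u i α * (starRingEnd ℂ) (u j β) with hc
  obtain ⟨hA, hA'⟩ := sum_integral_mul_const _ hint c
  obtain ⟨-, hB'⟩ := sum_integral_mul_const _ (fun i j α β => hint i α j β) c
  have hterm : ∀ i j α β, R i j α β * u i α * (starRingEnd ℂ) (u j β) = R i j α β * c i j α β :=
    fun i j α β => mul_assoc _ _ _
  set f : Ω → ℂ := fun w => ∑ i, ∑ α, u i α * (θ i w * (starRingEnd ℂ) (θ α w)) with hf
  have hfmeas : Measurable f := by fun_prop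
  have hfA : (fun p : Ω × Ω => (G p : ℂ) * f p.2 * (starRingEnd ℂ) (f p.1)) =
      fun p => ∑ i, ∑ j, ∑ α, ∑ β, ((G p : ℂ) * θ i p.2 * (starRingEnd ℂ) (θ α p.2) *
          (starRingEnd ℂ) (θ j p.1) * θ β p.1) * c i j α β := by
    funext p
    simp only [hf, map_sum, mul_sum_mul_sum]
    refine sum_congr rfl fun i _ => sum_congr rfl fun j _ => sum_congr rfl fun α _ =>
      sum_congr rfl fun β _ => ?_
    simp only [hc, map_mul, Complex.conj_conj]
    ring
  have hFB : (fun p : Ω × Ω => ∑ i, ∑ j, ∑ α, ∑ β,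
        ((G p : ℂ) * θ i p.2 * (starRingEnd ℂ) (θ j p.2) *
          (starRingEnd ℂ) (θ α p.1) * θ β p.1) * c i j α β) =
      fun p => ((G p * Complex.normSq
        (∑ i, ∑ α, u i α * (θ i p.2 * (starRingEnd ℂ) (θ α p.1))) : ℝ) : ℂ) := by
    funext p
    rw [Complex.ofReal_mul, Complex.normSq_eq_conj_mul_self, mul_comm ((starRingEnd ℂ) _),
      ← mul_assoc]
    simp only [map_sum, mul_sum_mul_sum]
    refine sum_congr rfl fun i _ => sum_congr rfl fun j _ => sum_congr rfl fun α _ =>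
      sum_congr rfl fun β _ => ?_
    simp only [hc, map_mul, Complex.conj_conj]
    ring
  obtain ⟨him, hre⟩ := hGpsd f hfmeas (by rw [hfA]; exact hA)
  simp only [hterm]
  simp only [hR, add_mul, sum_add_distrib]
  rw [hA', hB', ← hfA, hFB, integral_complex_ofReal, Complex.add_im, Complex.add_re,
    Complex.ofReal_im, Complex.ofReal_re, him]
  exact ⟨add_zero 0, add_nonneg hre (integral_nonneg fun p =>
    mul_nonneg (hGnonneg p.1 p.2) (Complex.normSq_nonneg _))⟩
end

section
/- Let (Ω, 𝒜, μ) be a σ-finite measure space, G : Ω × Ω → ℝ measurable, symmetric (G(z,w) = G(w,z)), with G(z,w) > 0 for μ⊗μ-almost every (z,w), and such that G is a positive-semidefinite kernel: for every measurable f : Ω → ℂ such that (z,w) ↦ G(z,w)·f(w)·conj(f(z)) is μ⊗μ-integrable, the integral ∬ G(z,w)·f(w)·conj(f(z)) d(μ⊗μ) is a real number ≥ 0. Let θ : Fin m → Ω → ℂ be measurable functions that are linearly independent modulo μ-null sets (if c ∈ ℂ^m and ∑ i, c i · θ i = 0 μ-almost everywhere, then c = 0), and such that for all indices i, j, α, β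 ∈ Fin m the function (z,w) ↦ G(z,w)·θ i (w)·conj(θ α (w))·conj(θ j (z))·θ β (z) is integrable with respect to μ ⊗ μ. Define R i j α β := ∬ G(z,w)·θ i (w)·conj(θ α (w))·conj(θ j (z))·θ β (z) d(μ⊗μ) + ∬ G(z,w)·θ i (w)·conj(θ j (w))·conj(θ α (z))·θ β (z) d(μ⊗μ). Then for every nonzero u ∈ Matrix (Fin m) (Fin m) ℂ, the sum ∑_{i,j,α,β} (R i j α β)·(u i α)·conj(u j β) is a real number > 0. (This is the strict Nakano positivity in the paper's theorem that the Weil–Petersson metric is Nakano-negative on the tangent bundle, i.e. Wolpert's curvature tensor on the cotangent bundle is Nakano-positive; strictness uses that the Green kernel is strictly positive and the Kodaira–Spencer map is injective, so the harmonic Beltrami differentials θ i are linearly independent.) -/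
open MeasureTheory Finset

open ComplexConjugate in
/-- Product expansion of a double sum with the conjugate of another one. -/
theorem mul_sum_sum_mul_conj_sum_sum {ι κ : Type*} [Fintype ι] [Fintype κ]
    (g : ℂ) (a b : ι → κ → ℂ) :
    g * (∑ i, ∑ k, a i k) * conj (∑ i, ∑ k, b i k) =
      ∑ i, ∑ j, ∑ k, ∑ l, g * a i k * conj (b j l) := by
  rw [mul_assoc]
  simp only [map_sum, Finset.sum_mul_sum]
  simp only [Finset.mul_sum, mul_assoc]

/-- A fourfold finite combination of integrals is the integral of the combination. -/
theorem integrable_and_integral_sum_mul_const {X ι : Type*} [MeasurableSpace X] [Fintype ι]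
    {ν : Measure X} {F : ι → ι → ι → ι → X → ℂ} (c : ι → ι → ι → ι → ℂ)
    (hF : ∀ i j k l, Integrable (F i j k l) ν) :
    Integrable (fun x => ∑ i, ∑ j, ∑ k, ∑ l, F i j k l x * c i j k l) ν ∧
      ∫ x, ∑ i, ∑ j, ∑ k, ∑ l, F i j k l x * c i j k l ∂ν =
        ∑ i, ∑ j, ∑ k, ∑ l, (∫ x, F i j k l x ∂ν) * c i j k l := by
  have h₀ : ∀ i j k l, Integrable (fun x => F i j k l x * c i j k l) ν :=
    fun i j k l => (hF i j k l).mul_const _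
  have h₁ : ∀ i j k, Integrable (fun x => ∑ l, F i j k l x * c i j k l) ν :=
    fun i j k => integrable_finsetSum _ fun l _ => h₀ i j k l
  have h₂ : ∀ i j, Integrable (fun x => ∑ k, ∑ l, F i j k l x * c i j k l) ν :=
    fun i j => integrable_finsetSum _ fun k _ => h₁ i j k
  have h₃ : ∀ i, Integrable (fun x => ∑ j, ∑ k, ∑ l, F i j k l x * c i j k l) ν :=
    fun i => integrable_finsetSum _ fun j _ => h₂ i j
  refine ⟨integrable_finsetSum _ fun i _ => h₃ i, ?_⟩
  rw [integral_finsetSum _ fun i _ => h₃ i]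
  refine Finset.sum_congr rfl fun i _ => ?_
  rw [integral_finsetSum _ fun j _ => h₂ i j]
  refine Finset.sum_congr rfl fun j _ => ?_
  rw [integral_finsetSum _ fun k _ => h₁ i j k]
  refine Finset.sum_congr rfl fun k _ => ?_
  rw [integral_finsetSum _ fun l _ => h₀ i j k l]
  simp only [integral_mul_const]

open ComplexConjugate in
/-- Functions that are linearly independent modulo null sets have linearly independent
sesquilinear products `θ i ⊗ conj (θ k)` on the product space. -/
theorem matrix_eq_zero_of_ae_sum_mul_conj_eq_zero {Ω ι : Type*} [MeasurableSpace Ω] [Fintype ι]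
    {μ : Measure Ω} [SFinite μ] {θ : ι → Ω → ℂ}
    (hθ : ∀ c : ι → ℂ, (∀ᵐ z ∂μ, (∑ i, c i * θ i z) = 0) → c = 0) (u : Matrix ι ι ℂ)
    (hu : ∀ᵐ p : Ω × Ω ∂(μ.prod μ), ∑ i, ∑ k, u i k * (θ i p.2 * conj (θ k p.1)) = 0) :
    u = 0 := by
  have hrow : ∀ᵐ z ∂μ, (fun i => ∑ k, u i k * conj (θ k z)) = 0 := by
    filter_upwards [Measure.ae_ae_of_ae_prod hu] with z hz
    refine hθ _ ?_
    filter_upwards [hz] with w hw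
    rw [← hw]
    refine Finset.sum_congr rfl fun i _ => ?_
    rw [Finset.sum_mul]
    exact Finset.sum_congr rfl fun k _ => by ring
  ext i k
  have hconj : (fun k => conj (u i k)) = 0 := by
    refine hθ _ ?_
    filter_upwards [hrow] with z hz
    simpa using congrArg conj (congrFun hz i)
  simpa using congrFun hconj k

/-- If `g > 0` and `g ‖H‖²` is integrable, its integral is positive unless `H` vanishes
almost everywhere. -/
theorem integral_mul_normSq_pos {X : Type*} [MeasurableSpace X] {ν : Measure X}
    {g : X → ℝ} {H : X → ℂ} (hg : ∀ᵐ x ∂ν, 0 < g x)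
    (hint : Integrable (fun x => g x * Complex.normSq (H x)) ν)
    (hH : ¬ ∀ᵐ x ∂ν, H x = 0) : 0 < ∫ x, g x * Complex.normSq (H x) ∂ν := by
  have hnn : 0 ≤ᵐ[ν] fun x => g x * Complex.normSq (H x) := by
    filter_upwards [hg] with x hx using mul_nonneg hx.le (Complex.normSq_nonneg _)
  refine (integral_nonneg_of_ae hnn).lt_of_ne' fun h => hH ?_
  filter_upwards [(integral_eq_zero_iff_of_nonneg_ae hnn hint).1 h, hg] with x hx hgx
  exact Complex.normSq_eq_zero.1 ((mul_eq_zero.1 hx).resolve_left hgx.ne')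

/-- Strict Nakano positivity of Wolpert's curvature coefficients: if the kernel `G`
is symmetric, a.e. strictly positive and positive-semidefinite, and the harmonic
Beltrami differentials `θ i` are linearly independent modulo null sets, then for
every nonzero matrix `u`, `∑ R i j α β · u i α · conj (u j β)` is a real number `> 0`. -/
theorem wolpert_nakano_strictly_positive {Ω : Type*} [MeasurableSpace Ω]
    (μ : Measure Ω) [SigmaFinite μ]
    (G : Ω × Ω → ℝ) (hGmeas : Measurable G)
    (hGsymm : ∀ z w, G (z, w) = G (w, z))
    (hGpos : ∀ᵐ p ∂(μ.prod μ), 0 < G p)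
    (hGpsd : ∀ f : Ω → ℂ, Measurable f →
      Integrable (fun p : Ω × Ω =>
        (G p : ℂ) * f p.2 * (starRingEnd ℂ) (f p.1)) (μ.prod μ) →
      ((∫ p : Ω × Ω, (G p : ℂ) * f p.2 * (starRingEnd ℂ) (f p.1) ∂(μ.prod μ)).im = 0 ∧
        0 ≤ (∫ p : Ω × Ω, (G p : ℂ) * f p.2 * (starRingEnd ℂ) (f p.1) ∂(μ.prod μ)).re))
    (m : ℕ) (θ : Fin m → Ω → ℂ) (hθmeas : ∀ i, Measurable (θ i))
    (hθindep : ∀ c : Fin m → ℂ, (∀ᵐ z ∂μ, (∑ i, c i * θ i z) = 0) → c = 0)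
    (hint : ∀ i j α β : Fin m, Integrable (fun p : Ω × Ω =>
        (G p : ℂ) * θ i p.2 * (starRingEnd ℂ) (θ α p.2) *
          (starRingEnd ℂ) (θ j p.1) * θ β p.1) (μ.prod μ))
    (R : Fin m → Fin m → Fin m → Fin m → ℂ)
    (hR : ∀ i j α β : Fin m, R i j α β =
        (∫ p : Ω × Ω, (G p : ℂ) * θ i p.2 * (starRingEnd ℂ) (θ α p.2) *
          (starRingEnd ℂ) (θ j p.1) * θ β p.1 ∂(μ.prod μ)) +
        (∫ p : Ω × Ω, (G p : ℂ) * θ i p.2 * (starRingEnd ℂ) (θ j p.2) *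
          (starRingEnd ℂ) (θ α p.1) * θ β p.1 ∂(μ.prod μ))) :
    ∀ u : Matrix (Fin m) (Fin m) ℂ, u ≠ 0 →
      (∑ i, ∑ j, ∑ α, ∑ β, R i j α β * u i α * (starRingEnd ℂ) (u j β)).im = 0 ∧
      0 < (∑ i, ∑ j, ∑ α, ∑ β, R i j α β * u i α * (starRingEnd ℂ) (u j β)).re := by
  intro u hu
  set f : Ω → ℂ := fun w => ∑ i, ∑ α, u i α * (θ i w * (starRingEnd ℂ) (θ α w)) with hf
  set H : Ω × Ω → ℂ :=
    fun p => ∑ i, ∑ α, u i α * (θ i p.2 * (starRingEnd ℂ) (θ α p.1)) with hH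
  set c : Fin m → Fin m → Fin m → Fin m → ℂ :=
    fun i j α β => u i α * (starRingEnd ℂ) (u j β) with hc
  obtain ⟨hfint, hfeq⟩ := integrable_and_integral_sum_mul_const c hint
  obtain ⟨hHint, hHeq⟩ :=
    integrable_and_integral_sum_mul_const c fun i j α β => hint i α j β
  have hfexp : ∀ p : Ω × Ω, (G p : ℂ) * f p.2 * (starRingEnd ℂ) (f p.1) =
      ∑ i, ∑ j, ∑ α, ∑ β, (G p : ℂ) * θ i p.2 * (starRingEnd ℂ) (θ α p.2) *
        (starRingEnd ℂ) (θ j p.1) * θ β p.1 * c i j α β := fun p => by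
    rw [hf, mul_sum_sum_mul_conj_sum_sum]
    refine sum_congr rfl fun i _ => sum_congr rfl fun j _ =>
      sum_congr rfl fun α _ => sum_congr rfl fun β _ => ?_
    simp only [hc, map_mul, Complex.conj_conj]
    ring
  have hHexp : ∀ p : Ω × Ω, ((G p * Complex.normSq (H p) : ℝ) : ℂ) =
      ∑ i, ∑ j, ∑ α, ∑ β, (G p : ℂ) * θ i p.2 * (starRingEnd ℂ) (θ j p.2) *
        (starRingEnd ℂ) (θ α p.1) * θ β p.1 * c i j α β := fun p => by
    rw [Complex.ofReal_mul, Complex.normSq_eq_conj_mul_self, mul_comm _ (H p), ← mul_assoc, hH,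
      mul_sum_sum_mul_conj_sum_sum]
    refine sum_congr rfl fun i _ => sum_congr rfl fun j _ =>
      sum_congr rfl fun α _ => sum_congr rfl fun β _ => ?_
    simp only [hc, map_mul, Complex.conj_conj]
    ring
  simp only [← hfexp] at hfint hfeq
  simp only [← hHexp] at hHint hHeq
  have hfmeas : Measurable f := by
    have := fun i => (continuous_star (R := ℂ)).measurable.comp (hθmeas i)
    exact Finset.measurable_fun_sum _ fun i _ => Finset.measurable_fun_sum _ fun α _ =>
      ((hθmeas i).mul (this α)).const_mul _
  obtain ⟨him, hre⟩ := hGpsd f hfmeas hfint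
  have hpos := integral_mul_normSq_pos hGpos (by simpa using hHint.re)
    fun h => hu (matrix_eq_zero_of_ae_sum_mul_conj_eq_zero hθindep u h)
  rw [integral_complex_ofReal] at hHeq
  have hsum : ∑ i, ∑ j, ∑ α, ∑ β, R i j α β * u i α * (starRingEnd ℂ) (u j β) =
      (∫ p : Ω × Ω, (G p : ℂ) * f p.2 * (starRingEnd ℂ) (f p.1) ∂(μ.prod μ)) +
        ((∫ p, G p * Complex.normSq (H p) ∂(μ.prod μ) : ℝ) : ℂ) := by
    rw [hfeq, hHeq]
    simp only [← sum_add_distrib, hR, hc, ← add_mul, mul_assoc]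
  rw [hsum, Complex.add_im, Complex.add_re, Complex.ofReal_im, Complex.ofReal_re, him]
  exact ⟨add_zero 0, add_pos_of_nonneg_of_pos hre hpos⟩
end

section
/- Let n ≥ 1 and let g ∈ Matrix (Fin n) (Fin n) ℂ be Hermitian positive definite: conj (g i j) = g j i for all i, j, and ∑_{i,j} (g i j)·(v i)·conj(v j) has positive real part for every nonzero v ∈ ℂ^n. Define R i j k l := −((g i j)·(g k l) + (g i l)·(g k j)). Then: (a) R is dual-Nakano-negative, i.e. for every nonzero M ∈ Matrix (Fin n) (Fin n) ℂ the dual-Nakano form D(M) := ∑_{i,j,k,l} (R i j k l)·(M i l)·conj(M j k) is a real number < 0; and (b) R is semi-Nakano-negative, i.e. for every M ∈ Matrix (Fin n) (Fin n) ℂ the Nakano form N(M) := ∑_{i,j,k,l} (R i j k l)·(M i k)·conj(M j l) is a real number ≤ 0. (This is the pointwise content of the paper's lemma that for a hyperbolic complex space form with its canonical metric, whose curvature tensor is R_{i j̄ k l̄} = −(g_{i j̄} g_{k l̄} + g_{i l̄} g_{k j̄}), the holomorphic tangent bundle is dual-Nakano-negative and semi-Nakano-negative.) -/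
open Finset

/-- The Nakano form `N(M) = ∑ R i j k l * M i k * conj (M j l)`. -/
noncomputable def nakanoForm {n : ℕ} (R : Fin n → Fin n → Fin n → Fin n → ℂ)
    (M : Matrix (Fin n) (Fin n) ℂ) : ℂ :=
  ∑ i, ∑ j, ∑ k, ∑ l, R i j k l * M i k * (starRingEnd ℂ) (M j l)

namespace Matrix

variable {m : Type*} [Fintype m]

theorem trace_conjTranspose_mul_self_mul_conjTranspose_mul_self (A B S : Matrix m m ℂ) :
    (Aᴴ * A * S * (Bᴴ * B) * Sᴴ).trace = ((A * S * Bᴴ) * (A * S * Bᴴ)ᴴ).trace := by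
  have h : (A * S * Bᴴ) * (A * S * Bᴴ)ᴴ = (A * S * Bᴴ * B * Sᴴ) * Aᴴ := by
    simp only [conjTranspose_mul, conjTranspose_conjTranspose, Matrix.mul_assoc]
  rw [h, trace_mul_comm _ Aᴴ]
  simp only [Matrix.mul_assoc]

open scoped MatrixOrder ComplexOrder in
/-- The Hermitian form `S ↦ tr (P S Q Sᴴ)` is positive semidefinite when `P` and `Q` are. -/
theorem PosSemidef.trace_mul_mul_mul_conjTranspose_nonneg {P Q : Matrix m m ℂ}
    (hP : P.PosSemidef) (hQ : Q.PosSemidef) (S : Matrix m m ℂ) :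
    0 ≤ (P * S * Q * Sᴴ).trace := by
  classical
  obtain ⟨A, rfl⟩ := CStarAlgebra.nonneg_iff_eq_star_mul_self.mp hP.nonneg
  obtain ⟨B, rfl⟩ := CStarAlgebra.nonneg_iff_eq_star_mul_self.mp hQ.nonneg
  simp only [star_eq_conjTranspose]
  rw [trace_conjTranspose_mul_self_mul_conjTranspose_mul_self]
  exact (posSemidef_self_mul_conjTranspose _).trace_nonneg

open scoped MatrixOrder ComplexOrder in
/-- The Hermitian form `S ↦ tr (P S Q Sᴴ)` is positive definite when `P` and `Q` are. -/
theorem PosDef.trace_mul_mul_mul_conjTranspose_pos {P Q : Matrix m m ℂ}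
    (hP : P.PosDef) (hQ : Q.PosDef) {S : Matrix m m ℂ} (hS : S ≠ 0) :
    0 < (P * S * Q * Sᴴ).trace := by
  classical
  refine (hP.posSemidef.trace_mul_mul_mul_conjTranspose_nonneg hQ.posSemidef S).lt_of_ne' ?_
  obtain ⟨A, rfl⟩ := CStarAlgebra.nonneg_iff_eq_star_mul_self.mp hP.posSemidef.nonneg
  obtain ⟨B, rfl⟩ := CStarAlgebra.nonneg_iff_eq_star_mul_self.mp hQ.posSemidef.nonneg
  have hA : IsUnit A := by
    have h := hP.isUnit
    rw [isUnit_iff_isUnit_det, det_mul] at h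
    exact (isUnit_iff_isUnit_det A).2 (isUnit_of_mul_isUnit_right h)
  have hB : IsUnit Bᴴ := by
    have h := hQ.isUnit
    rw [isUnit_iff_isUnit_det, det_mul] at h
    exact (isUnit_iff_isUnit_det Bᴴ).2 (isUnit_of_mul_isUnit_left h)
  simp only [star_eq_conjTranspose]
  rw [trace_conjTranspose_mul_self_mul_conjTranspose_mul_self, Ne,
    trace_mul_conjTranspose_self_eq_zero_iff, hB.mul_left_eq_zero, hA.mul_right_eq_zero]
  exact hS

theorem trace_mul_mul_mul_eq_sum (A B C D : Matrix m m ℂ) :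
    (A * B * C * D).trace = ∑ i, ∑ j, ∑ k, ∑ l, A j i * B i k * C k l * D l j := by
  simp only [trace, diag_apply, mul_apply, sum_mul]
  rw [sum_comm (f := fun i j => ∑ k, ∑ l, A j i * B i k * C k l * D l j)]
  refine sum_congr rfl fun j _ => ?_
  rw [sum_comm, sum_comm (f := fun i k => ∑ l, A j i * B i k * C k l * D l j)]
  exact sum_congr rfl fun k _ => sum_comm

end Matrix

open scoped Matrix

theorem dualNakanoForm_spaceForm {n : ℕ} {g : Matrix (Fin n) (Fin n) ℂ} (hg : g.IsHermitian)
    {R : Fin n → Fin n → Fin n → Fin n → ℂ}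
    (hR : ∀ i j k l, R i j k l = -(g i j * g k l + g i l * g k j))
    (M : Matrix (Fin n) (Fin n) ℂ) :
    dualNakanoForm R M =
      -((gᵀ * M * gᵀ * Mᴴ).trace + (gᵀ * M).trace * (starRingEnd ℂ) (gᵀ * M).trace) := by
  have h₁ : (gᵀ * M * gᵀ * Mᴴ).trace =
      ∑ i, ∑ j, ∑ k, ∑ l, g i j * g k l * M i l * (starRingEnd ℂ) (M j k) := by
    rw [Matrix.trace_mul_mul_mul_eq_sum]
    refine sum_congr rfl fun i _ => sum_congr rfl fun j _ => ?_
    rw [sum_comm]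
    refine sum_congr rfl fun k _ => sum_congr rfl fun l _ => ?_
    simp only [Matrix.transpose_apply, Matrix.conjTranspose_apply, starRingEnd_apply]
    ring
  have h₂ : (gᵀ * M).trace * (starRingEnd ℂ) (gᵀ * M).trace =
      ∑ i, ∑ j, ∑ k, ∑ l, g i l * g k j * M i l * (starRingEnd ℂ) (M j k) := by
    have htr : (gᵀ * M).trace = ∑ i, ∑ l, g i l * M i l := by
      simp only [Matrix.trace, Matrix.diag_apply, Matrix.mul_apply, Matrix.transpose_apply]
      exact sum_comm
    have hconj : (starRingEnd ℂ) (gᵀ * M).trace =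
        ∑ j, ∑ k, g k j * (starRingEnd ℂ) (M j k) := by
      simp only [htr, map_sum, map_mul, starRingEnd_apply, hg.apply]
    rw [hconj, htr, sum_mul]
    refine sum_congr rfl fun i _ => ?_
    rw [mul_sum]
    refine sum_congr rfl fun j _ => ?_
    rw [mul_sum]
    refine sum_congr rfl fun k _ => ?_
    rw [sum_mul]
    exact sum_congr rfl fun l _ => by ring
  rw [h₁, h₂]
  simp only [dualNakanoForm, hR, ← sum_add_distrib, ← sum_neg_distrib]
  exact sum_congr rfl fun i _ => sum_congr rfl fun j _ => sum_congr rfl fun k _ =>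
    sum_congr rfl fun l _ => by ring

theorem nakanoForm_spaceForm {n : ℕ} {g : Matrix (Fin n) (Fin n) ℂ}
    {R : Fin n → Fin n → Fin n → Fin n → ℂ}
    (hR : ∀ i j k l, R i j k l = -(g i j * g k l + g i l * g k j))
    (M : Matrix (Fin n) (Fin n) ℂ) :
    nakanoForm R M = -(1 / 2) * (gᵀ * (M + Mᵀ) * g * (M + Mᵀ)ᴴ).trace := by
  have h_trace : nakanoForm R M = -((gᵀ * M * g * Mᴴ).trace + (gᵀ * M * g * Mᵀᴴ).trace) := by
    have h_swap : (gᵀ * M * g * Mᵀᴴ).trace =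
        ∑ i, ∑ j, ∑ k, ∑ l, g i l * M i k * g k j * star (M j l) := by
      rw [Matrix.trace_mul_mul_mul_eq_sum]
      refine sum_congr rfl fun i _ => ?_
      rw [sum_comm, sum_comm (f := fun j k => ∑ l, g i l * M i k * g k j * star (M j l))]
      exact sum_congr rfl fun k _ => sum_comm
    rw [h_swap, Matrix.trace_mul_mul_mul_eq_sum]
    simp only [nakanoForm, hR, ← sum_add_distrib, ← sum_neg_distrib]
    refine sum_congr rfl fun i _ => sum_congr rfl fun j _ => sum_congr rfl fun k _ =>
      sum_congr rfl fun l _ => ?_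
    simp only [Matrix.transpose_apply, Matrix.conjTranspose_apply, starRingEnd_apply]
    ring
  have h_transpose (X Y : Matrix (Fin n) (Fin n) ℂ) :
      (gᵀ * Xᵀ * g * Y).trace = (gᵀ * X * g * Yᵀ).trace := by
    rw [← Matrix.trace_transpose]
    simp only [Matrix.transpose_mul, Matrix.transpose_transpose, Matrix.mul_assoc]
    rw [Matrix.trace_mul_comm]
    simp only [Matrix.mul_assoc]
  have h_cross : (gᵀ * Mᵀ * g * Mᴴ).trace = (gᵀ * M * g * Mᵀᴴ).trace := h_transpose M Mᴴ
  have h_diag : (gᵀ * Mᵀ * g * Mᵀᴴ).trace = (gᵀ * M * g * Mᴴ).trace := h_transpose M Mᵀᴴ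
  rw [h_trace, Matrix.conjTranspose_add]
  simp only [Matrix.mul_add, Matrix.add_mul, Matrix.trace_add, h_cross, h_diag]
  ring

/-- The curvature tensor `R_{i j̄ k l̄} = -(g_{i j̄} g_{k l̄} + g_{i l̄} g_{k j̄})`
of a hyperbolic complex space form is dual-Nakano-negative and semi-Nakano-negative. -/
theorem spaceForm_dualNakano_neg_and_semiNakano_neg (n : ℕ) (hn : 1 ≤ n)
    (g : Matrix (Fin n) (Fin n) ℂ)
    (hHerm : ∀ i j, (starRingEnd ℂ) (g i j) = g j i)
    (hPos : ∀ v : Fin n → ℂ, v ≠ 0 →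
        0 < (∑ i, ∑ j, g i j * v i * (starRingEnd ℂ) (v j)).re)
    (R : Fin n → Fin n → Fin n → Fin n → ℂ)
    (hR : ∀ i j k l, R i j k l = -(g i j * g k l + g i l * g k j)) :
    (∀ M : Matrix (Fin n) (Fin n) ℂ, M ≠ 0 →
        (dualNakanoForm R M).im = 0 ∧ (dualNakanoForm R M).re < 0) ∧
    (∀ M : Matrix (Fin n) (Fin n) ℂ,
        (nakanoForm R M).im = 0 ∧ (nakanoForm R M).re ≤ 0) := by
  have hg : g.IsHermitian := Matrix.IsHermitian.ext fun i j => hHerm j i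
  open scoped ComplexOrder in
  have hgT : gᵀ.PosDef := by
    refine Matrix.PosDef.of_dotProduct_mulVec_pos hg.transpose fun v hv => ?_
    have him := hg.transpose.im_star_dotProduct_mulVec_self v
    have hre := hPos v hv
    have h : star v ⬝ᵥ (gᵀ *ᵥ v) = ∑ i, ∑ j, g i j * v i * (starRingEnd ℂ) (v j) := by
      simp only [dotProduct, Matrix.mulVec, mul_sum, Matrix.transpose_apply]
      rw [sum_comm]
      exact sum_congr rfl fun i _ => sum_congr rfl fun j _ => by
        simp only [Pi.star_apply, starRingEnd_apply]; ring
    rw [← h] at hre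
    exact Complex.pos_iff.2 ⟨hre, him.symm⟩
  have hgP : g.PosDef := by simpa using hgT.transpose
  refine ⟨fun M hM => ?_, fun M => ?_⟩
  · have h := Complex.pos_iff.1 (hgT.trace_mul_mul_mul_conjTranspose_pos hgT hM)
    rw [dualNakanoForm_spaceForm hg hR, Complex.mul_conj]
    have := Complex.normSq_nonneg (gᵀ * M).trace
    simp only [Complex.neg_im, Complex.add_im, Complex.ofReal_im, Complex.neg_re, Complex.add_re,
      Complex.ofReal_re]
    constructor <;> linarith
  · have h := Complex.nonneg_iff.1
      (hgT.posSemidef.trace_mul_mul_mul_conjTranspose_nonneg hgP.posSemidef (M + Mᵀ))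
    rw [nakanoForm_spaceForm hR]
    have h₂ : (-(1 / 2) : ℂ) = ((-(1 / 2) : ℝ) : ℂ) := by push_cast; rfl
    rw [h₂, Complex.im_ofReal_mul, Complex.re_ofReal_mul]
    constructor <;> linarith
end

section
/- Let n ≥ 1 and let g ∈ Matrix (Fin n) (Fin n) ℂ be Hermitian positive definite: conj (g i j) = g j i for all i, j, and ∑_{i,j} (g i j)·(v i)·conj(v j) has positive real part for every nonzero v ∈ ℂ^n. Define R i j k l := (g i j)·(g k l) + (g i l)·(g k j). Then: (a) R is dual-Nakano-positive, i.e. for every nonzero M ∈ Matrix (Fin n) (Fin n) ℂ the dual-Nakano form D(M) := ∑_{i,j,k,l} (R i j k l)·(M i l)·conj(M j k) is a real number > 0; and (b) R is semi-Nakano-positive, i.e. for every M ∈ Matrix (Fin n) (Fin n) ℂ the Nakano form N(M) := ∑_{i,j,k,l} (R i j k l)·(M i k)·conj(M j l) is a real number ≥ 0. (This is the pointwise content of the paper's lemma and example that the holomorphic tangent bundle of complex projective space with the Fubini–Study metric, whose curvature tensor is R_{i j̄ k l̄} = g_{i j̄} g_{k l̄} + g_{i l̄} g_{k j̄}, is dual-Nakano-positive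 and semi-Nakano-positive.) -/
open Finset

open scoped Matrix ComplexOrder MatrixOrder Matrix.Norms.L2Operator

lemma exists_isUnit_transpose_eq_mul_conjTranspose {n : ℕ} {g : Matrix (Fin n) (Fin n) ℂ}
    (hHerm : ∀ i j, (starRingEnd ℂ) (g i j) = g j i)
    (hPos : ∀ v : Fin n → ℂ, v ≠ 0 →
        0 < (∑ i, ∑ j, g i j * v i * (starRingEnd ℂ) (v j)).re) :
    ∃ P : Matrix (Fin n) (Fin n) ℂ, IsUnit P ∧ gᵀ = P * Pᴴ := by
  have hH : gᵀ.IsHermitian := by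
    ext i j
    exact hHerm i j
  have hpd : gᵀ.PosDef := by
    refine Matrix.PosDef.of_dotProduct_mulVec_pos hH fun v hv => ?_
    refine Complex.pos_iff.mpr ⟨?_, (hH.im_star_dotProduct_mulVec_self v).symm⟩
    convert hPos v hv using 2
    rw [sum_comm]
    simp only [dotProduct, Matrix.mulVec, mul_sum]
    refine sum_congr rfl fun i _ => sum_congr rfl fun j _ => ?_
    simp only [Pi.star_apply, Matrix.transpose_apply, starRingEnd_apply]
    ring
  obtain ⟨P, hP, h⟩ := CStarAlgebra.isStrictlyPositive_iff_eq_mul_star_self.mp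
    hpd.isStrictlyPositive
  exact ⟨P, hP, h⟩

lemma dualNakanoForm_eq_trace {n : ℕ} (g M : Matrix (Fin n) (Fin n) ℂ)
    (hHerm : ∀ i j, (starRingEnd ℂ) (g i j) = g j i) :
    dualNakanoForm (fun i j k l => g i j * g k l + g i l * g k j) M =
      (M * gᵀ * Mᴴ * gᵀ).trace + (M * gᵀ).trace * star (M * gᵀ).trace := by
  simp only [dualNakanoForm, add_mul, sum_add_distrib]
  congr 1
  · simp only [Matrix.trace, Matrix.diag, Matrix.mul_apply, sum_mul, Matrix.transpose_apply,
      Matrix.conjTranspose_apply, starRingEnd_apply]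
    refine sum_congr rfl fun i _ => sum_congr rfl fun j _ => sum_congr rfl fun k _ =>
      sum_congr rfl fun l _ => ?_
    ring
  · simp only [Matrix.trace, Matrix.diag, Matrix.mul_apply, Matrix.transpose_apply,
      ← starRingEnd_apply, map_sum, map_mul, hHerm]
    rw [sum_mul]
    refine sum_congr rfl fun i _ => ?_
    rw [mul_sum]
    refine sum_congr rfl fun j _ => ?_
    rw [mul_comm, sum_mul_sum]
    refine sum_congr rfl fun k _ => sum_congr rfl fun l _ => ?_
    ring

lemma nakanoForm_eq_trace {n : ℕ} (g M : Matrix (Fin n) (Fin n) ℂ) :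
    nakanoForm (fun i j k l => g i j * g k l + g i l * g k j) M =
      (M * g * Mᴴ * gᵀ).trace + (M * g * Mᴴᵀ * gᵀ).trace := by
  simp only [nakanoForm, add_mul, sum_add_distrib]
  congr 1
  · simp only [Matrix.trace, Matrix.diag, Matrix.mul_apply, sum_mul, Matrix.transpose_apply,
      Matrix.conjTranspose_apply, starRingEnd_apply]
    refine sum_congr rfl fun i _ => sum_congr rfl fun j _ => ?_
    rw [sum_comm]
    refine sum_congr rfl fun k _ => sum_congr rfl fun l _ => ?_
    ring
  · simp only [Matrix.trace, Matrix.diag, Matrix.mul_apply, sum_mul, Matrix.transpose_apply,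
      Matrix.conjTranspose_apply, starRingEnd_apply]
    refine sum_congr rfl fun i _ => ?_
    calc _ = ∑ j, ∑ l, ∑ k, g i l * g k j * M i k * star (M j l) :=
          sum_congr rfl fun j _ => sum_comm
      _ = ∑ l, ∑ j, ∑ k, g i l * g k j * M i k * star (M j l) := sum_comm
      _ = _ := by
        refine sum_congr rfl fun l _ => sum_congr rfl fun j _ => sum_congr rfl fun k _ => ?_
        ring

lemma trace_mul_conjTranspose_add_trace_mul_conj {m : Type*} [Fintype m] (E : Matrix m m ℂ) :
    (E * Eᴴ).trace + (E * Eᴴᵀ).trace = 2⁻¹ * ((E + Eᵀ) * (E + Eᵀ)ᴴ).trace := by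
  have h₁ : (Eᵀ * Eᴴᵀ).trace = (E * Eᴴ).trace := by
    rw [← Matrix.transpose_mul, Matrix.trace_transpose, Matrix.trace_mul_comm]
  have h₂ : (Eᵀ * Eᴴ).trace = (E * Eᴴᵀ).trace := by
    rw [← Matrix.trace_transpose, Matrix.transpose_mul, Matrix.transpose_transpose,
      Matrix.trace_mul_comm]
  have h₃ : Eᵀᴴ = Eᴴᵀ := rfl
  rw [Matrix.conjTranspose_add, h₃, add_mul, mul_add, mul_add]
  simp only [Matrix.trace_add, h₁, h₂]
  ring

/-- The curvature tensor `R_{i j̄ k l̄} = g_{i j̄} g_{k l̄} + g_{i l̄} g_{k j̄}`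
of the Fubini–Study metric is dual-Nakano-positive and semi-Nakano-positive. -/
theorem fubiniStudy_dualNakano_pos_and_semiNakano_pos (n : ℕ) (hn : 1 ≤ n)
    (g : Matrix (Fin n) (Fin n) ℂ)
    (hHerm : ∀ i j, (starRingEnd ℂ) (g i j) = g j i)
    (hPos : ∀ v : Fin n → ℂ, v ≠ 0 →
        0 < (∑ i, ∑ j, g i j * v i * (starRingEnd ℂ) (v j)).re)
    (R : Fin n → Fin n → Fin n → Fin n → ℂ)
    (hR : ∀ i j k l, R i j k l = g i j * g k l + g i l * g k j) :
    (∀ M : Matrix (Fin n) (Fin n) ℂ, M ≠ 0 →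
        (dualNakanoForm R M).im = 0 ∧ 0 < (dualNakanoForm R M).re) ∧
    (∀ M : Matrix (Fin n) (Fin n) ℂ,
        (nakanoForm R M).im = 0 ∧ 0 ≤ (nakanoForm R M).re) := by
  obtain rfl : R = fun i j k l => g i j * g k l + g i l * g k j := by
    funext i j k l
    exact hR i j k l
  obtain ⟨P, hP, hg⟩ := exists_isUnit_transpose_eq_mul_conjTranspose hHerm hPos
  refine ⟨fun M hM => ?_, fun M => ?_⟩
  · suffices h : 0 < dualNakanoForm (fun i j k l => g i j * g k l + g i l * g k j) M from
      ⟨(Complex.pos_iff.mp h).2.symm, (Complex.pos_iff.mp h).1⟩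
    rw [dualNakanoForm_eq_trace g M hHerm]
    refine add_pos_of_pos_of_nonneg ?_ (mul_star_self_nonneg _)
    have htr : (M * gᵀ * Mᴴ * gᵀ).trace = ((Pᴴ * M * P) * (Pᴴ * M * P)ᴴ).trace := by
      rw [hg, ← mul_assoc _ P, Matrix.trace_mul_comm]
      simp only [Matrix.conjTranspose_mul, Matrix.conjTranspose_conjTranspose, mul_assoc]
    rw [htr]
    refine (Matrix.posSemidef_self_mul_conjTranspose _).trace_nonneg.lt_of_ne' ?_
    rw [Ne, Matrix.trace_mul_conjTranspose_self_eq_zero_iff, hP.mul_left_eq_zero,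
      (show IsUnit Pᴴ from hP.star).mul_right_eq_zero]
    exact hM
  · suffices h : 0 ≤ nakanoForm (fun i j k l => g i j * g k l + g i l * g k j) M from
      ⟨(Complex.nonneg_iff.mp h).2.symm, (Complex.nonneg_iff.mp h).1⟩
    have hg' : g = Pᴴᵀ * Pᵀ := by
      rw [← Matrix.transpose_mul, ← hg, Matrix.transpose_transpose]
    have h₁ : (M * g * Mᴴ * gᵀ).trace =
        ((Pᴴ * M * Pᴴᵀ) * (Pᴴ * M * Pᴴᵀ)ᴴ).trace := by
      have hc : Pᴴᵀᴴ = Pᵀ := by ext; simp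
      rw [hg, ← mul_assoc _ P, Matrix.trace_mul_comm, hg']
      simp only [Matrix.conjTranspose_mul, Matrix.conjTranspose_conjTranspose, mul_assoc, hc]
    have h₂ : (M * g * Mᴴᵀ * gᵀ).trace =
        ((Pᴴ * M * Pᴴᵀ) * (Pᴴ * M * Pᴴᵀ)ᴴᵀ).trace := by
      have hc : Pᴴᵀᴴᵀ = P := by ext; simp
      rw [hg, ← mul_assoc _ P, Matrix.trace_mul_comm, hg']
      simp only [Matrix.conjTranspose_mul, Matrix.transpose_mul,
        Matrix.conjTranspose_conjTranspose, mul_assoc, hc]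
    rw [nakanoForm_eq_trace, h₁, h₂, trace_mul_conjTranspose_add_trace_mul_conj]
    exact mul_nonneg (inv_nonneg.mpr zero_le_two)
      (Matrix.posSemidef_self_mul_conjTranspose _).trace_nonneg
end
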